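/- arXiv:2006.02186 — 2 statements merged into one kernel-verified Lean document; each statement's English description precedes it below -/
import Mathlib

section
/- Let ξ ∈ L^1(Ω;ℝ^d) and α ∈ (0,1]. Then for every u ∈ ℝ^d, e_α(⟨ξ,u⟩) = sup{⟨E(ξ f(ξ)), u⟩ : f : ℝ^d → [0, α^{-1}] measurable with E f(ξ) = 1}; consequently the average quantile set E_α(ξ) coincides with the zonoid-trimmed region Z_α(ξ) = {E(ξ f(ξ)) : f : ℝ^d → [0, α^{-1}] measurable, E f(ξ) = 1}. -/
open MeasureTheory RealInnerProductSpace

/-- The `t`-quantile of a distribution `ν` on `ℝ`: `q_t = inf {s : ν(-∞,s] ≥ t}`. -/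
noncomputable def quantile (ν : Measure ℝ) (t : ℝ) : ℝ :=
  sInf {s : ℝ | t ≤ (ν (Set.Iic s)).toReal}

/-- The average quantile `e_α(β) = α⁻¹ ∫_{1−α}^1 q_t(β) dt` of a distribution `ν` on `ℝ`. -/
noncomputable def avgQuantile (ν : Measure ℝ) (α : ℝ) : ℝ :=
  α⁻¹ * ∫ t in Set.Ioc (1 - α) 1, quantile ν t

/-- The average quantile set `E_α(ξ)`: the convex closed set with support function
`u ↦ e_α(⟨ξ,u⟩)`. -/
def avgQuantileSet {Ω : Type*} [MeasureSpace Ω] {d : ℕ}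
    (ξ : Ω → EuclideanSpace ℝ (Fin d)) (α : ℝ) : Set (EuclideanSpace ℝ (Fin d)) :=
  {x | ∀ u : EuclideanSpace ℝ (Fin d),
    ⟪x, u⟫ ≤ avgQuantile (Measure.map (fun ω => ⟪ξ ω, u⟫) volume) α}

/-- The zonoid-trimmed region
`Z_α(ξ) = {E(ξ f(ξ)) : f : ℝ^d → [0,α⁻¹] measurable, E f(ξ) = 1}`. -/
def zonoidTrimmed {Ω : Type*} [MeasureSpace Ω] {d : ℕ}
    (ξ : Ω → EuclideanSpace ℝ (Fin d)) (α : ℝ) : Set (EuclideanSpace ℝ (Fin d)) :=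
  {y | ∃ f : EuclideanSpace ℝ (Fin d) → ℝ, Measurable f ∧
    (∀ v, f v ∈ Set.Icc (0:ℝ) α⁻¹) ∧ (∫ ω, f (ξ ω)) = 1 ∧ y = ∫ ω, f (ξ ω) • ξ ω}

open Set Filter Topology ProbabilityTheory

section Hilbert

variable {H F : Type*} [NormedAddCommGroup H] [InnerProductSpace ℝ H] [CompleteSpace H]
  [NormedAddCommGroup F] [NormedSpace ℝ F]

/-- A continuous linear map sends closed bounded convex subsets of a Hilbert space to closed
sets. -/
theorem isClosed_image_of_convex_of_isBounded {K : Set H} (hconv : Convex ℝ K)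
    (hcl : IsClosed K) (hbdd : Bornology.IsBounded K) (T : H →L[ℝ] F) : IsClosed (T '' K) := by
  refine isClosed_of_closure_subset fun y hy => ?_
  let C : ℕ → Set H := fun n => K ∩ T ⁻¹' Metric.closedBall y (1 / ((n : ℝ) + 1))
  have hCne (n : ℕ) : (C n).Nonempty := by
    obtain ⟨_, ⟨f, hf, rfl⟩, hlt⟩ := Metric.mem_closure_iff.1 hy (1 / ((n : ℝ) + 1)) (by positivity)
    exact ⟨f, hf, by simpa [dist_comm] using hlt.le⟩
  have hCconv (n : ℕ) : Convex ℝ (C n) :=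
    hconv.inter ((convex_closedBall _ _).linear_preimage T.toLinearMap)
  have hCcl (n : ℕ) : IsClosed (C n) := hcl.inter (Metric.isClosed_closedBall.preimage T.continuous)
  have hCanti {n m : ℕ} (h : n ≤ m) : C m ⊆ C n := by
    refine inter_subset_inter_right _ (preimage_mono (Metric.closedBall_subset_closedBall ?_))
    gcongr
  choose g hgC hgmin using fun n =>
    exists_norm_eq_iInf_of_complete_convex (hCne n) (hCcl n).isComplete (hCconv n) 0
  have hdist {n m : ℕ} (h : n ≤ m) : ‖g m - g n‖ ^ 2 ≤ ‖g m‖ ^ 2 - ‖g n‖ ^ 2 := by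
    have := (norm_eq_iInf_iff_real_inner_le_zero (hCconv n) (hgC n)).1 (hgmin n) _
      (hCanti h (hgC m))
    rw [zero_sub, inner_neg_left, inner_sub_right, real_inner_self_eq_norm_sq] at this
    rw [norm_sub_sq_real, real_inner_comm]
    linarith
  obtain ⟨R, hR⟩ := hbdd.exists_norm_le
  have hmono : Monotone fun n => ‖g n‖ ^ 2 := fun n m h => by
    have := hdist h
    nlinarith [sq_nonneg ‖g m - g n‖]
  have hbound : BddAbove (range fun n => ‖g n‖ ^ 2) := by
    refine ⟨R ^ 2, ?_⟩
    rintro _ ⟨n, rfl⟩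
    exact pow_le_pow_left₀ (norm_nonneg _) (hR _ (hgC n).1) 2
  have hcauchy : CauchySeq g := by
    have hlim := (tendsto_atTop_ciSup hmono hbound).cauchySeq
    rw [Metric.cauchySeq_iff'] at hlim ⊢
    intro ε hε
    obtain ⟨N, hN⟩ := hlim (ε ^ 2) (by positivity)
    refine ⟨N, fun n hn => ?_⟩
    have h1 := hN n hn
    rw [Real.dist_eq] at h1
    rw [dist_eq_norm]
    exact lt_of_pow_lt_pow_left₀ 2 hε.le
      (((hdist hn).trans (le_abs_self _)).trans_lt h1)
  obtain ⟨f, hf⟩ := cauchySeq_tendsto_of_complete hcauchy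
  refine ⟨f, hcl.mem_of_tendsto hf (Eventually.of_forall fun n => (hgC n).1), ?_⟩
  refine tendsto_nhds_unique ((T.continuous.tendsto f).comp hf) ?_
  rw [tendsto_iff_dist_tendsto_zero]
  exact squeeze_zero (fun _ => dist_nonneg) (fun n => (hgC n).2)
    tendsto_one_div_add_atTop_nhds_zero_nat

end Hilbert

section Quantile

variable (ν : Measure ℝ) [IsProbabilityMeasure ν]

theorem quantile_le_iff {t : ℝ} (ht : t ∈ Ioo (0 : ℝ) 1) (s : ℝ) :
    quantile ν t ≤ s ↔ t ≤ cdf ν s := by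
  have hset : {s : ℝ | t ≤ (ν (Iic s)).toReal} = {s | t ≤ cdf ν s} := by
    ext s
    simp [cdf_eq_real, measureReal_def]
  have hne : {s | t ≤ cdf ν s}.Nonempty :=
    ((tendsto_cdf_atTop ν).eventually (eventually_ge_nhds ht.2)).exists
  have hbdd : BddBelow {s | t ≤ cdf ν s} := by
    obtain ⟨b, hb⟩ := ((tendsto_cdf_atBot ν).eventually (eventually_lt_nhds ht.1)).exists
    exact ⟨b, fun s hs => le_of_not_gt fun h =>
      absurd (hs.trans (monotone_cdf ν h.le)) (not_le.2 hb)⟩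
  rw [quantile, hset]
  refine ⟨fun h => ?_, fun h => csInf_le hbdd h⟩
  have hr : ∀ᶠ r in 𝓝[>] s, t ≤ cdf ν r := by
    filter_upwards [self_mem_nhdsWithin] with r hr
    obtain ⟨x, hx, hxr⟩ := (csInf_lt_iff hbdd hne).1 (h.trans_lt hr)
    exact le_trans hx (monotone_cdf ν hxr.le)
  exact ge_of_tendsto (((cdf ν).right_continuous s).mono Ioi_subset_Ici_self) hr

theorem quantile_monotoneOn : MonotoneOn (quantile ν) (Ioo 0 1) := fun _ ha _ hb hab =>
  (quantile_le_iff ν ha _).2 (hab.trans ((quantile_le_iff ν hb _).1 le_rfl))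

theorem aemeasurable_quantile : AEMeasurable (quantile ν) (volume.restrict (Ioo 0 1)) :=
  aemeasurable_restrict_of_monotoneOn measurableSet_Ioo (quantile_monotoneOn ν)

/-- The quantile function transports the uniform distribution on `(0, 1)` to `ν`. -/
theorem map_quantile : Measure.map (quantile ν) (volume.restrict (Ioo 0 1)) = ν := by
  have : IsFiniteMeasure (Measure.map (quantile ν) (volume.restrict (Ioo (0 : ℝ) 1))) := by
    infer_instance
  refine Measure.ext_of_Iic _ _ fun s => ?_
  rw [Measure.map_apply_of_aemeasurable (aemeasurable_quantile ν) measurableSet_Iic,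
    Measure.restrict_apply' measurableSet_Ioo]
  have hset : quantile ν ⁻¹' Iic s ∩ Ioo 0 1 = Ioo 0 1 ∩ Iic (cdf ν s) := by
    ext t
    simp only [mem_inter_iff, mem_preimage, mem_Iic]
    rw [and_comm]
    exact and_congr_right fun ht => quantile_le_iff ν ht s
  have hae : (Ioo 0 1 ∩ Iic (cdf ν s) : Set ℝ) =ᵐ[volume] Ioc 0 (cdf ν s) := by
    have h1 : (Ioo (0 : ℝ) 1 ∩ Iic (cdf ν s) : Set ℝ) =ᵐ[volume]
        (Ioc (0 : ℝ) 1 ∩ Iic (cdf ν s) : Set ℝ) := Ioo_ae_eq_Ioc.inter (ae_eq_refl _)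
    rwa [Ioc_inter_Iic, inf_eq_right.2 (cdf_le_one ν s)] at h1
  rw [hset, measure_congr hae, Real.volume_Ioc, sub_zero, cdf_eq_real, ofReal_measureReal]

theorem integral_comp_quantile {g : ℝ → ℝ} (hg : Measurable g) :
    ∫ t in Ioo 0 1, g (quantile ν t) = ∫ x, g x ∂ν := by
  conv_rhs => rw [← map_quantile ν]
  rw [integral_map (aemeasurable_quantile ν) hg.aestronglyMeasurable]

variable {ν}

theorem integrableOn_quantile (hν : Integrable id ν) : IntegrableOn (quantile ν) (Ioo 0 1) := by
  rw [← map_quantile ν] at hν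
  exact (integrable_map_measure measurable_id.aestronglyMeasurable
    (aemeasurable_quantile ν)).1 hν

theorem avgQuantile_one : avgQuantile ν 1 = ∫ x, x ∂ν := by
  rw [avgQuantile, inv_one, one_mul, sub_self, integral_Ioc_eq_integral_Ioo]
  exact integral_comp_quantile ν measurable_id

/-- The Rockafellar–Uryasev representation of the average quantile. -/
theorem avgQuantile_eq (hν : Integrable id ν) {α : ℝ} (hα : α ∈ Ioo (0 : ℝ) 1) :
    avgQuantile ν α = quantile ν (1 - α) + α⁻¹ * ∫ x, max (x - quantile ν (1 - α)) 0 ∂ν := by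
  set s := quantile ν (1 - α) with hs
  have hα' : 1 - α ∈ Ioo (0 : ℝ) 1 := ⟨by linarith [hα.2], by linarith [hα.1]⟩
  have hsub : Ioo (1 - α) 1 ⊆ Ioo (0 : ℝ) 1 := Ioo_subset_Ioo_left hα'.1.le
  have hpos : ∫ x, max (x - s) 0 ∂ν = ∫ t in Ioo (1 - α) 1, (quantile ν t - s) := by
    rw [← integral_comp_quantile ν (g := fun x => max (x - s) 0) (by fun_prop)]
    rw [setIntegral_congr_fun (g := (Ioo (1 - α) 1).indicator fun t => quantile ν t - s)
      measurableSet_Ioo, setIntegral_indicator measurableSet_Ioo, inter_eq_right.2 hsub]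
    intro t ht
    by_cases h : 1 - α < t
    · have : s ≤ quantile ν t := quantile_monotoneOn ν hα' ht h.le
      simp [indicator, h, ht.2, this]
    · have : quantile ν t ≤ s := quantile_monotoneOn ν ht hα' (not_lt.1 h)
      simp [indicator, h, this]
  rw [hpos, integral_sub ((integrableOn_quantile hν).mono_set hsub) (integrable_const s),
    avgQuantile, integral_Ioc_eq_integral_Ioo]
  simp only [integral_const, measureReal_restrict_apply_univ, Real.volume_real_Ioo, smul_eq_mul]
  rw [max_eq_left (by linarith [hα.1])]
  field_simp [hα.1.ne']
  ring

theorem measureReal_Ioi_quantile_le {α : ℝ} (hα : α ∈ Ioo (0 : ℝ) 1) :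
    ν.real (Ioi (quantile ν (1 - α))) ≤ α := by
  have h := (quantile_le_iff ν (t := 1 - α) ⟨by linarith [hα.2], by linarith [hα.1]⟩ _).1 le_rfl
  rw [cdf_eq_real] at h
  rw [← compl_Iic, probReal_compl_eq_one_sub measurableSet_Iic]
  linarith

theorem le_measureReal_Ici_quantile {α : ℝ} (hα : α ∈ Ioo (0 : ℝ) 1) :
    α ≤ ν.real (Ici (quantile ν (1 - α))) := by
  have hα' : 1 - α ∈ Ioo (0 : ℝ) 1 := ⟨by linarith [hα.2], by linarith [hα.1]⟩
  set s := quantile ν (1 - α) with hs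
  have hle : ν.real (Iio s) ≤ 1 - α := by
    rw [measureReal_def]
    conv_lhs => rw [← map_quantile ν]
    rw [Measure.map_apply_of_aemeasurable (aemeasurable_quantile ν) measurableSet_Iio,
      Measure.restrict_apply' measurableSet_Ioo]
    have hsub : quantile ν ⁻¹' Iio s ∩ Ioo 0 1 ⊆ Ioo 0 (1 - α) := fun t ht =>
      ⟨ht.2.1, lt_of_not_ge fun h => absurd (quantile_monotoneOn ν hα' ht.2 h) (not_le.2 ht.1)⟩
    refine ENNReal.toReal_le_of_le_ofReal hα'.1.le ((measure_mono hsub).trans ?_)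
    rw [Real.volume_Ioo, sub_zero]
  rw [← compl_Iio, probReal_compl_eq_one_sub measurableSet_Iio]
  linarith

theorem exists_density_integral_eq_avgQuantile (hν : Integrable id ν) {α : ℝ}
    (hα : α ∈ Ioc (0 : ℝ) 1) :
    ∃ φ : ℝ → ℝ, Measurable φ ∧ (∀ x, φ x ∈ Icc 0 α⁻¹) ∧ ∫ x, φ x ∂ν = 1 ∧
      ∫ x, φ x * x ∂ν = avgQuantile ν α := by
  rcases hα.2.eq_or_lt with rfl | hα1
  · exact ⟨fun _ => 1, measurable_const, fun _ => by simp, by simp, by simp [avgQuantile_one]⟩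
  have hα' : α ∈ Ioo (0 : ℝ) 1 := ⟨hα.1, hα1⟩
  set s := quantile ν (1 - α) with hs
  have hIoi := measureReal_Ioi_quantile_le (ν := ν) hα'
  have hIci := le_measureReal_Ici_quantile (ν := ν) hα'
  rw [← hs] at hIoi hIci
  have hsplit : ν.real (Ici s) = ν.real {s} + ν.real (Ioi s) := by
    rw [← measureReal_union (by simp) measurableSet_Ioi]
    congr 1
    ext x
    simp [le_iff_eq_or_lt, eq_comm]
  obtain ⟨c, hc0, hc1, hc⟩ : ∃ c : ℝ, 0 ≤ c ∧ c ≤ 1 ∧ c * ν.real {s} = α - ν.real (Ioi s) := by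
    rcases (measureReal_nonneg : 0 ≤ ν.real {s}).eq_or_lt with h0 | h0
    · exact ⟨0, le_rfl, zero_le_one, by linarith⟩
    · exact ⟨(α - ν.real (Ioi s)) / ν.real {s}, div_nonneg (by linarith) h0.le,
        (div_le_one h0).2 (by linarith), div_mul_cancel₀ _ h0.ne'⟩
  have hinv : 0 < α⁻¹ := inv_pos.2 hα.1
  let φ : ℝ → ℝ := fun x =>
    (Ioi s).indicator (fun _ => α⁻¹) x + ({s} : Set ℝ).indicator (fun _ => α⁻¹ * c) x
  have hφm : Measurable φ := (measurable_const.indicator measurableSet_Ioi).add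
    (measurable_const.indicator (measurableSet_singleton s))
  have hφb (x : ℝ) : φ x ∈ Icc 0 α⁻¹ := by
    rcases lt_trichotomy x s with h | rfl | h
    · simp [φ, indicator, h.not_gt, h.ne, hinv.le]
    · simp only [φ, indicator, mem_Ioi, lt_irrefl, if_false, mem_singleton_iff, if_true, zero_add]
      exact ⟨by positivity, mul_le_of_le_one_right hinv.le hc1⟩
    · simp [φ, indicator, h, h.ne', hinv.le]
  have hφ1 : ∫ x, φ x ∂ν = 1 := by
    simp only [φ]
    rw [integral_add ((integrable_const _).indicator measurableSet_Ioi)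
      ((integrable_const _).indicator (measurableSet_singleton s)),
      integral_indicator_const _ measurableSet_Ioi,
      integral_indicator_const _ (measurableSet_singleton s), smul_eq_mul, smul_eq_mul]
    have hα0 := hα.1.ne'
    calc ν.real (Ioi s) * α⁻¹ + ν.real {s} * (α⁻¹ * c)
        = α⁻¹ * (ν.real (Ioi s) + c * ν.real {s}) := by ring
      _ = 1 := by rw [hc]; field_simp; ring
  refine ⟨φ, hφm, hφb, hφ1, ?_⟩
  have hpt (x : ℝ) : φ x * x = φ x * s + α⁻¹ * max (x - s) 0 := by
    rcases lt_trichotomy x s with h | rfl | h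
    · simp [φ, indicator, h.not_gt, h.ne, h.le]
    · simp
    · simp only [φ, indicator, mem_Ioi, h, if_true, mem_singleton_iff, h.ne', if_false, add_zero,
        max_eq_left (sub_nonneg.2 h.le)]
      ring
  have hφint : Integrable φ ν := Integrable.of_bound hφm.aestronglyMeasurable α⁻¹
    (ae_of_all _ fun x => by rw [Real.norm_of_nonneg (hφb x).1]; exact (hφb x).2)
  have hmax : Integrable (fun x => max (x - s) 0) ν := (hν.sub (integrable_const s)).pos_part
  simp_rw [hpt]
  rw [integral_add (hφint.mul_const s) (hmax.const_mul _), integral_mul_const, hφ1, one_mul,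
    integral_const_mul, avgQuantile_eq hν hα']

end Quantile

theorem integral_mul_le_avgQuantile {Ω : Type*} [MeasurableSpace Ω] {P : Measure Ω}
    [IsProbabilityMeasure P] {β γ : Ω → ℝ} (hβm : Measurable β) (hβ : Integrable β P)
    (hγm : Measurable γ) {α : ℝ} (hα : α ∈ Ioc (0 : ℝ) 1) (hγ : ∀ ω, γ ω ∈ Icc 0 α⁻¹)
    (hγ1 : ∫ ω, γ ω ∂P = 1) :
    ∫ ω, γ ω * β ω ∂P ≤ avgQuantile (Measure.map β P) α := by
  have : IsProbabilityMeasure (Measure.map β P) :=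
    Measure.isProbabilityMeasure_map hβm.aemeasurable
  have hν : Integrable id (Measure.map β P) :=
    (integrable_map_measure measurable_id.aestronglyMeasurable hβm.aemeasurable).2 hβ
  have hγbound : ∀ᵐ ω ∂P, ‖γ ω‖ ≤ α⁻¹ :=
    ae_of_all _ fun ω => by rw [Real.norm_of_nonneg (hγ ω).1]; exact (hγ ω).2
  have hγint : Integrable γ P := Integrable.of_bound hγm.aestronglyMeasurable α⁻¹ hγbound
  rcases hα.2.eq_or_lt with rfl | hα1
  · have hae : (fun ω => 1 - γ ω) =ᵐ[P] 0 := by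
      refine (integral_eq_zero_iff_of_nonneg (fun ω => ?_) ((integrable_const 1).sub hγint)).1 ?_
      · simpa using (hγ ω).2
      · rw [integral_sub' (integrable_const 1) hγint, hγ1]
        simp
    rw [avgQuantile_one, integral_map hβm.aemeasurable (by fun_prop)]
    refine (integral_congr_ae ?_).le
    filter_upwards [hae] with ω hω
    have : γ ω = 1 := by
      simp only [Pi.zero_apply] at hω
      linarith
    rw [this, one_mul]
  rw [avgQuantile_eq hν ⟨hα.1, hα1⟩]
  set s := quantile (Measure.map β P) (1 - α)
  rw [integral_map hβm.aemeasurable (by fun_prop)]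
  have hmax : Integrable (fun ω => max (β ω - s) 0) P := (hβ.sub (integrable_const s)).pos_part
  calc ∫ ω, γ ω * β ω ∂P ≤ ∫ ω, (γ ω * s + α⁻¹ * max (β ω - s) 0) ∂P := by
        refine integral_mono (hβ.bdd_mul hγm.aestronglyMeasurable hγbound)
          ((hγint.mul_const s).add (hmax.const_mul _)) fun ω => ?_
        have h1 : γ ω * (β ω - s) ≤ γ ω * max (β ω - s) 0 :=
          mul_le_mul_of_nonneg_left (le_max_left _ _) (hγ ω).1
        have h2 : γ ω * max (β ω - s) 0 ≤ α⁻¹ * max (β ω - s) 0 :=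
          mul_le_mul_of_nonneg_right (hγ ω).2 (le_max_right _ _)
        simp only
        linarith
    _ = s + α⁻¹ * ∫ ω, max (β ω - s) 0 ∂P := by
        rw [integral_add (hγint.mul_const s) (hmax.const_mul _), integral_mul_const, hγ1, one_mul,
          integral_const_mul]

section Zonoid

variable {d : ℕ}

/-- The lift zonoid of `μ` with densities bounded by `c`. -/
def liftZonoid (μ : Measure (EuclideanSpace ℝ (Fin d))) (c : ℝ) :
    Set (ℝ × EuclideanSpace ℝ (Fin d)) :=
  {p | ∃ f : EuclideanSpace ℝ (Fin d) → ℝ, Measurable f ∧ (∀ v, f v ∈ Icc 0 c) ∧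
    p = (∫ v, f v ∂μ, ∫ v, f v • v ∂μ)}

/-- The lift zonoid is the image of an order interval of `L²(μ)` under a continuous linear map:
the densities are multiplied by the weight `√(1 + ‖v‖)`, which lies in `L²(μ)` and makes the
first moment functional continuous. -/
theorem exists_liftZonoid_eq_image {μ : Measure (EuclideanSpace ℝ (Fin d))} [IsFiniteMeasure μ]
    (hμ : Integrable id μ) {c : ℝ} (hc : 0 ≤ c) :
    ∃ (b : Lp ℝ 2 μ) (T : Lp ℝ 2 μ →L[ℝ] ℝ × EuclideanSpace ℝ (Fin d)),
      liftZonoid μ c = T '' Icc 0 b := by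
  let ρ : EuclideanSpace ℝ (Fin d) → ℝ := fun v => √(1 + ‖v‖)
  have hρm : Measurable ρ := by fun_prop
  have hρ1 (v) : 1 ≤ ρ v := Real.one_le_sqrt.2 (by linarith [norm_nonneg v])
  have hρ0 (v) : 0 < ρ v := zero_lt_one.trans_le (hρ1 v)
  have hρsq (v) : ρ v ^ 2 = 1 + ‖v‖ := Real.sq_sqrt (by positivity)
  have hρ : MemLp ρ 2 μ := by
    rw [memLp_two_iff_integrable_sq hρm.aestronglyMeasurable]
    simp_rw [hρsq]
    exact (integrable_const 1).add hμ.norm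
  have hweight {k : EuclideanSpace ℝ (Fin d) → ℝ} (hk : Measurable k)
      (hkb : ∀ v, |k v| ≤ 1 + ‖v‖) : MemLp (fun v => k v / ρ v) 2 μ := by
    refine hρ.mono (hk.div hρm).aestronglyMeasurable (ae_of_all _ fun v => ?_)
    rw [norm_div, Real.norm_eq_abs, Real.norm_of_nonneg (hρ0 v).le, div_le_iff₀ (hρ0 v), ← sq,
      hρsq]
    exact hkb v
  have hone := hweight (k := fun _ => 1) measurable_const fun v => by simp
  have hcoord (i : Fin d) := hweight (k := fun v => v i) (by fun_prop) fun v => by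
    have := PiLp.norm_apply_le v i
    rw [Real.norm_eq_abs] at this
    linarith
  have hinner {k : EuclideanSpace ℝ (Fin d) → ℝ} (hk : MemLp (fun v => k v / ρ v) 2 μ)
      {f : EuclideanSpace ℝ (Fin d) → ℝ} {g : Lp ℝ 2 μ} (hg : g =ᵐ[μ] fun v => f v * ρ v) :
      ⟪hk.toLp, g⟫ = ∫ v, f v * k v ∂μ := by
    rw [L2.inner_def]
    refine integral_congr_ae ?_
    filter_upwards [hk.coeFn_toLp, hg] with v h1 h2
    rw [h1, h2]
    have := (hρ0 v).ne'
    simp only [RCLike.inner_apply, conj_trivial]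
    field_simp
  let T : Lp ℝ 2 μ →L[ℝ] ℝ × EuclideanSpace ℝ (Fin d) :=
    (innerSL ℝ hone.toLp).prod
      ((EuclideanSpace.equiv (Fin d) ℝ).symm.toContinuousLinearMap ∘L
        ContinuousLinearMap.pi fun i => innerSL ℝ (hcoord i).toLp)
  have hT {f : EuclideanSpace ℝ (Fin d) → ℝ} (hf : Measurable f) (hfc : ∀ v, f v ∈ Icc 0 c)
      {g : Lp ℝ 2 μ} (hg : g =ᵐ[μ] fun v => f v * ρ v) :
      T g = (∫ v, f v ∂μ, ∫ v, f v • v ∂μ) := by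
    have hint : Integrable (fun v => f v • v) μ :=
      hμ.bdd_smul c hf.aestronglyMeasurable
        (ae_of_all _ fun v => by rw [Real.norm_of_nonneg (hfc v).1]; exact (hfc v).2)
    refine Prod.ext ?_ ?_
    · change ⟪hone.toLp, g⟫ = _
      rw [hinner hone hg]
      simp
    · ext i
      change ⟪(hcoord i).toLp, g⟫ = EuclideanSpace.proj (𝕜 := ℝ) i (∫ v, f v • v ∂μ)
      rw [hinner (hcoord i) hg, ← ContinuousLinearMap.integral_comp_comm _ hint]
      rfl
  have hb : MemLp (fun v => c * ρ v) 2 μ := hρ.const_mul c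
  refine ⟨hb.toLp, T, Set.ext fun p => ⟨?_, ?_⟩⟩
  · rintro ⟨f, hf, hfc, rfl⟩
    have hfρ : MemLp (fun v => f v * ρ v) 2 μ := by
      refine hb.mono (hf.mul hρm).aestronglyMeasurable (ae_of_all _ fun v => ?_)
      rw [Real.norm_of_nonneg (mul_nonneg (hfc v).1 (hρ0 v).le),
        Real.norm_of_nonneg (mul_nonneg hc (hρ0 v).le)]
      exact mul_le_mul_of_nonneg_right (hfc v).2 (hρ0 v).le
    refine ⟨hfρ.toLp, ⟨?_, ?_⟩, hT hf hfc hfρ.coeFn_toLp⟩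
    · rw [← Lp.coeFn_nonneg]
      filter_upwards [hfρ.coeFn_toLp] with v h
      rw [h]
      exact mul_nonneg (hfc v).1 (hρ0 v).le
    · rw [← Lp.coeFn_le]
      filter_upwards [hfρ.coeFn_toLp, hb.coeFn_toLp] with v h h'
      rw [h, h']
      exact mul_le_mul_of_nonneg_right (hfc v).2 (hρ0 v).le
  · rintro ⟨g, ⟨hg0, hgb⟩, rfl⟩
    have hgm : Measurable g := (Lp.stronglyMeasurable g).measurable
    let f : EuclideanSpace ℝ (Fin d) → ℝ := fun v => max 0 (min c (g v / ρ v))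
    have hf : Measurable f := measurable_const.max (measurable_const.min (hgm.div hρm))
    have hfc (v) : f v ∈ Icc 0 c := ⟨le_max_left _ _, max_le hc (min_le_left _ _)⟩
    refine ⟨f, hf, hfc, hT hf hfc ?_⟩
    filter_upwards [(Lp.coeFn_nonneg g).2 hg0, (Lp.coeFn_le _ _).2 hgb, hb.coeFn_toLp]
      with v h0 h1 h2
    rw [h2] at h1
    simp only [f]
    rw [min_eq_right ((div_le_iff₀ (hρ0 v)).2 h1), max_eq_right (div_nonneg h0 (hρ0 v).le),
      div_mul_cancel₀ _ (hρ0 v).ne']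

theorem convex_liftZonoid_and_isClosed {μ : Measure (EuclideanSpace ℝ (Fin d))}
    [IsFiniteMeasure μ] (hμ : Integrable id μ) {c : ℝ} (hc : 0 ≤ c) :
    Convex ℝ (liftZonoid μ c) ∧ IsClosed (liftZonoid μ c) := by
  obtain ⟨b, T, hT⟩ := exists_liftZonoid_eq_image hμ hc
  have hsmul {a : ℝ} (ha : 0 ≤ a) {f g : Lp ℝ 2 μ} (hfg : f ≤ g) : a • f ≤ a • g := by
    rw [← Lp.coeFn_le] at hfg ⊢
    filter_upwards [hfg, Lp.coeFn_smul a f, Lp.coeFn_smul a g] with v h h1 h2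
    rw [h1, h2]
    exact mul_le_mul_of_nonneg_left h ha
  have : PosSMulMono ℝ (Lp ℝ 2 μ) := ⟨fun _ ha _ _ hfg => hsmul ha hfg⟩
  have hconv : Convex ℝ (Icc 0 b) := convex_Icc 0 b
  have hbdd : Bornology.IsBounded (Icc 0 b) := by
    refine isBounded_iff_forall_norm_le.2 ⟨‖b‖, fun f hf => norm_le_norm_of_abs_le_abs ?_⟩
    rw [abs_of_nonneg hf.1, abs_of_nonneg (hf.1.trans hf.2)]
    exact hf.2
  rw [hT]
  exact ⟨hconv.linear_image T.toLinearMap,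
    isClosed_image_of_convex_of_isBounded hconv isClosed_Icc hbdd T⟩

variable {Ω : Type*} [MeasureSpace Ω] {ξ : Ω → EuclideanSpace ℝ (Fin d)} {α : ℝ}

theorem inner_integral_smul (hξ : Integrable ξ) {f : EuclideanSpace ℝ (Fin d) → ℝ}
    (hξm : Measurable ξ) (hf : Measurable f) {c : ℝ} (hfc : ∀ v, f v ∈ Icc 0 c)
    (u : EuclideanSpace ℝ (Fin d)) :
    ⟪∫ ω, f (ξ ω) • ξ ω, u⟫ = ∫ ω, f (ξ ω) * ⟪ξ ω, u⟫ := by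
  have hint : Integrable fun ω => f (ξ ω) • ξ ω :=
    hξ.bdd_smul c (hf.comp hξm).aestronglyMeasurable
      (ae_of_all _ fun ω => by
        rw [Function.comp_apply, Real.norm_of_nonneg (hfc _).1]; exact (hfc _).2)
  rw [real_inner_comm, ← integral_inner hint]
  refine integral_congr_ae (ae_of_all _ fun ω => ?_)
  simp only
  rw [real_inner_smul_right, real_inner_comm]

variable [IsProbabilityMeasure (volume : Measure Ω)]

theorem convex_zonoidTrimmed_and_isClosed (hξm : Measurable ξ) (hξ : Integrable ξ)
    (hα : 0 < α) : Convex ℝ (zonoidTrimmed ξ α) ∧ IsClosed (zonoidTrimmed ξ α) := by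
  have hμ : Integrable id (Measure.map ξ volume) :=
    (integrable_map_measure measurable_id.aestronglyMeasurable hξm.aemeasurable).2 hξ
  have heq : zonoidTrimmed ξ α =
      (fun y => ((1 : ℝ), y)) ⁻¹' liftZonoid (Measure.map ξ volume) α⁻¹ := by
    ext y
    refine exists_congr fun f => and_congr_right fun hf => and_congr_right fun _ => ?_
    rw [integral_map hξm.aemeasurable hf.aestronglyMeasurable,
      integral_map hξm.aemeasurable (by fun_prop), Prod.mk_inj,
      eq_comm (a := (1 : ℝ))]
  obtain ⟨hconv, hcl⟩ := convex_liftZonoid_and_isClosed hμ (inv_pos.2 hα).le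
  rw [heq]
  refine ⟨fun x hx y hy a b ha hb hab => ?_, hcl.preimage (by fun_prop)⟩
  have := hconv hx hy ha hb hab
  simpa [hab] using this

/-- The average quantile of `⟪ξ, u⟫` is the value of the support function of the zonoid-trimmed
region, which is attained. -/
theorem isGreatest_avgQuantile (hξm : Measurable ξ) (hξ : Integrable ξ) (hα : α ∈ Ioc (0 : ℝ) 1)
    (u : EuclideanSpace ℝ (Fin d)) :
    IsGreatest {r : ℝ | ∃ f : EuclideanSpace ℝ (Fin d) → ℝ, Measurable f ∧
      (∀ v, f v ∈ Icc (0 : ℝ) α⁻¹) ∧ (∫ ω, f (ξ ω)) = 1 ∧ r = ⟪∫ ω, f (ξ ω) • ξ ω, u⟫}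
      (avgQuantile (Measure.map (fun ω => ⟪ξ ω, u⟫) volume) α) := by
  have hβm : Measurable fun ω => ⟪ξ ω, u⟫ := hξm.inner_const
  have hβ : Integrable fun ω => ⟪ξ ω, u⟫ := hξ.inner_const u
  constructor
  · have : IsProbabilityMeasure (Measure.map (fun ω => ⟪ξ ω, u⟫) volume) :=
      Measure.isProbabilityMeasure_map hβm.aemeasurable
    have hν : Integrable id (Measure.map (fun ω => ⟪ξ ω, u⟫) volume) :=
      (integrable_map_measure measurable_id.aestronglyMeasurable hβm.aemeasurable).2 hβ
    obtain ⟨φ, hφm, hφc, hφ1, hφ⟩ := exists_density_integral_eq_avgQuantile hν hα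
    have hfm : Measurable fun v : EuclideanSpace ℝ (Fin d) => φ ⟪v, u⟫ :=
      hφm.comp measurable_id.inner_const
    refine ⟨fun v => φ ⟪v, u⟫, hfm, fun v => hφc _, ?_, ?_⟩
    · rw [← hφ1, integral_map hβm.aemeasurable hφm.aestronglyMeasurable]
    · rw [inner_integral_smul hξ hξm hfm (fun v => hφc _), ← hφ,
        integral_map hβm.aemeasurable (by fun_prop)]
  · rintro _ ⟨f, hfm, hfc, hf1, rfl⟩
    rw [inner_integral_smul hξ hξm hfm hfc]
    exact integral_mul_le_avgQuantile hβm hβ (hfm.comp hξm) hα (fun ω => hfc _) hf1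

end Zonoid

/-- for `ξ ∈ L¹(Ω;ℝ^d)` and `α ∈ (0,1]`, the support function identity
`e_α(⟨ξ,u⟩) = sup {⟨E(ξ f(ξ)),u⟩ : f : ℝ^d → [0,α⁻¹] measurable, E f(ξ) = 1}` holds for
every `u ∈ ℝ^d`, and consequently `E_α(ξ) = Z_α(ξ)`. -/
theorem statement6
    {Ω : Type*} [MeasureSpace Ω] [IsProbabilityMeasure (volume : Measure Ω)]
    {d : ℕ}
    (ξ : Ω → EuclideanSpace ℝ (Fin d)) (hξmeas : Measurable ξ) (hξint : Integrable ξ)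
    (α : ℝ) (hα : α ∈ Set.Ioc (0:ℝ) 1) :
    (∀ u : EuclideanSpace ℝ (Fin d),
      avgQuantile (Measure.map (fun ω => ⟪ξ ω, u⟫) volume) α =
        sSup {r : ℝ | ∃ f : EuclideanSpace ℝ (Fin d) → ℝ, Measurable f ∧
          (∀ v, f v ∈ Set.Icc (0:ℝ) α⁻¹) ∧ (∫ ω, f (ξ ω)) = 1 ∧
          r = ⟪∫ ω, f (ξ ω) • ξ ω, u⟫}) ∧
    avgQuantileSet ξ α = zonoidTrimmed ξ α := by
  refine ⟨fun u => (isGreatest_avgQuantile hξmeas hξint hα u).csSup_eq.symm, ?_⟩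
  refine Subset.antisymm (fun x hx => ?_) ?_
  · by_contra hxZ
    obtain ⟨hconv, hcl⟩ := convex_zonoidTrimmed_and_isClosed hξmeas hξint hα.1
    obtain ⟨l, c, hlt, hgt⟩ := geometric_hahn_banach_closed_point hconv hcl hxZ
    obtain ⟨u, rfl⟩ := (InnerProductSpace.toDual ℝ (EuclideanSpace ℝ (Fin d))).surjective l
    obtain ⟨f, hfm, hfc, hf1, hf⟩ := (isGreatest_avgQuantile hξmeas hξint hα u).1
    have h1 := hlt _ ⟨f, hfm, hfc, hf1, rfl⟩
    have h2 := hx u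
    rw [InnerProductSpace.toDual_apply_apply, real_inner_comm] at h1 hgt
    linarith
  · rintro _ ⟨f, hfm, hfc, hf1, rfl⟩ u
    exact (isGreatest_avgQuantile hξmeas hξint hα u).2 ⟨f, hfm, hfc, hf1, rfl⟩
end

section
/- Let p ∈ [1,∞) and let K and L be convex bodies in ℝ^d (compact convex sets with nonempty interior). Then there exists a probability measure γ on ℝ^d × ℝ^d whose first marginal is the uniform distribution on K and whose second marginal is the uniform distribution on L, such that (∬ ‖x − y‖^p γ(dx,dy))^{1/p} ≤ (V_d(K △ L) / max(V_d(K), V_d(L)))^{1/p} · diam(K ∪ L). Equivalently, there exist random vectors ξ and η on a common probability space, uniformly distributed on K and L respectively, with ‖ξ − η‖_p bounded by the same quantity. -/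
open MeasureTheory

/-- The uniform distribution on a set `K` in `ℝ^d`: normalized Lebesgue measure on `K`. -/
noncomputable def unifOn {d : ℕ} (K : Set (EuclideanSpace ℝ (Fin d))) :
    Measure (EuclideanSpace ℝ (Fin d)) :=
  (volume K)⁻¹ • volume.restrict K

/-- Two probability measures dominating a common measure `m` have a coupling that gives mass at most
`1 - m univ` to the complement of the diagonal. -/
theorem exists_coupling_compl_diagonal_le {E : Type*} [MeasurableSpace E] [MeasurableEq E]
    (μ ν m : Measure E) [IsProbabilityMeasure μ] [IsProbabilityMeasure ν]
    (hμ : m ≤ μ) (hν : m ≤ ν) :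
    ∃ γ : Measure (E × E), γ.map Prod.fst = μ ∧ γ.map Prod.snd = ν ∧
      γ (Set.diagonal E)ᶜ ≤ 1 - m Set.univ := by
  have : IsFiniteMeasure m := isFiniteMeasure_of_le μ hμ
  set t : ENNReal := 1 - m Set.univ with ht
  have ht_top : t ≠ ⊤ := ENNReal.sub_ne_top ENNReal.one_ne_top
  have hμt : (μ - m) Set.univ = t := by
    rw [Measure.sub_apply MeasurableSet.univ hμ, measure_univ]
  have hνt : (ν - m) Set.univ = t := by
    rw [Measure.sub_apply MeasurableSet.univ hν, measure_univ]
  have hdiag : Measurable fun x : E => (x, x) := measurable_id.prodMk measurable_id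
  have cancel : ∀ ρ : Measure E, ρ Set.univ = t → t⁻¹ • t • ρ = ρ := by
    intro ρ hρ
    rcases eq_or_ne t 0 with h0 | h0
    · rw [h0, Measure.measure_univ_eq_zero] at hρ
      simp [hρ]
    · rw [smul_smul, ENNReal.inv_mul_cancel h0 ht_top, one_smul]
  refine ⟨m.map (fun x => (x, x)) + t⁻¹ • (μ - m).prod (ν - m), ?_, ?_, ?_⟩
  · rw [Measure.map_add _ _ measurable_fst, Measure.map_smul, Measure.map_fst_prod, hνt,
      Measure.map_map measurable_fst hdiag, cancel _ hμt]
    exact (congrArg (· + (μ - m)) Measure.map_id).trans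
      ((add_comm _ _).trans (Measure.sub_add_cancel_of_le hμ))
  · rw [Measure.map_add _ _ measurable_snd, Measure.map_smul, Measure.map_snd_prod, hμt,
      Measure.map_map measurable_snd hdiag, cancel _ hνt]
    exact (congrArg (· + (ν - m)) Measure.map_id).trans
      ((add_comm _ _).trans (Measure.sub_add_cancel_of_le hν))
  · rw [Measure.add_apply, Measure.map_apply hdiag measurableSet_diagonal.compl]
    have hempty : (fun x : E => (x, x)) ⁻¹' (Set.diagonal E)ᶜ = ∅ := by
      ext x; simp
    rw [hempty, measure_empty, zero_add, Measure.smul_apply, smul_eq_mul]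
    calc t⁻¹ * (μ - m).prod (ν - m) (Set.diagonal E)ᶜ
        ≤ t⁻¹ * (μ - m).prod (ν - m) Set.univ := by gcongr; exact Set.subset_univ _
      _ = t⁻¹ * t * t := by
        rw [← Set.univ_prod_univ, Measure.prod_prod, hμt, hνt, mul_assoc]
      _ ≤ 1 * t := by gcongr; exact ENNReal.inv_mul_le_one t
      _ = t := one_mul t

/-- The `p`-cost of a measure on a product whose marginals are carried by a bounded set `S` is at
most its mass off the diagonal times `diam S ^ p`. -/
theorem integral_norm_sub_rpow_le_measureReal_mul_diam {E : Type*} [NormedAddCommGroup E]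
    [MeasurableSpace E] [MeasurableEq E] {γ : Measure (E × E)} [IsFiniteMeasure γ]
    {S : Set E} (hS : Bornology.IsBounded S) {p : ℝ} (hp : 0 < p)
    (hfst : ∀ᵐ x ∂γ.map Prod.fst, x ∈ S) (hsnd : ∀ᵐ x ∂γ.map Prod.snd, x ∈ S) :
    ∫ z, ‖z.1 - z.2‖ ^ p ∂γ ≤ γ.real (Set.diagonal E)ᶜ * Metric.diam S ^ p := by
  have hmeas : MeasurableSet (Set.diagonal E)ᶜ := measurableSet_diagonal.compl
  rw [← smul_eq_mul, ← integral_indicator_const _ hmeas]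
  refine integral_mono_of_nonneg (ae_of_all _ fun z => by positivity)
    ((integrable_const _).indicator hmeas) ?_
  filter_upwards [ae_of_ae_map measurable_fst.aemeasurable hfst,
    ae_of_ae_map measurable_snd.aemeasurable hsnd] with z h1 h2
  by_cases hz : z.1 = z.2
  · simp [hz, Real.zero_rpow hp.ne']
  · rw [Set.indicator_of_mem (by simpa using hz), ← dist_eq_norm]
    gcongr
    exact Metric.dist_le_diam_of_mem hS h1 h2

theorem isProbabilityMeasure_unifOn {d : ℕ} {K : Set (EuclideanSpace ℝ (Fin d))}
    (h0 : volume K ≠ 0) (htop : volume K ≠ ⊤) : IsProbabilityMeasure (unifOn K) :=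
  ⟨by simp [unifOn, ENNReal.inv_mul_cancel h0 htop]⟩

theorem ae_unifOn_mem {d : ℕ} {K : Set (EuclideanSpace ℝ (Fin d))} (hK : MeasurableSet K) :
    ∀ᵐ x ∂unifOn K, x ∈ K :=
  Measure.ae_smul_measure (ae_restrict_mem hK) _

theorem smul_restrict_le_unifOn {d : ℕ} {K M : Set (EuclideanSpace ℝ (Fin d))}
    {c : ENNReal} (hM : M ⊆ K) (hc : volume K ≤ c) :
    c⁻¹ • volume.restrict M ≤ unifOn K := by
  refine Measure.le_iff.2 fun s _ => ?_
  simp only [unifOn, Measure.smul_apply, smul_eq_mul]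
  gcongr

theorem one_sub_measure_inter_div_max_le {α : Type*} [MeasurableSpace α] (μ : Measure α)
    {K L : Set α} (hK : μ K ≠ 0) (hKtop : μ K ≠ ⊤) (hLtop : μ L ≠ ⊤) :
    1 - (max (μ K) (μ L))⁻¹ * μ (K ∩ L) ≤ μ (symmDiff K L) / max (μ K) (μ L) := by
  have h0 : max (μ K) (μ L) ≠ 0 := (lt_max_of_lt_left hK.bot_lt).ne'
  have htop : max (μ K) (μ L) ≠ ⊤ := (max_lt hKtop.lt_top hLtop.lt_top).ne
  have hle : max (μ K) (μ L) ≤ μ (symmDiff K L) + μ (K ∩ L) := by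
    refine (max_le (measure_mono ?_) (measure_mono ?_)).trans (measure_union_le _ _) <;>
    · intro x hx
      simp only [Set.mem_union, Set.mem_symmDiff, Set.mem_inter_iff]
      tauto
  rw [tsub_le_iff_right, mul_comm, ← div_eq_mul_inv, ← ENNReal.add_div,
    ← ENNReal.div_self h0 htop]
  gcongr

/-- for `p ∈ [1,∞)` and convex bodies `K, L ⊆ ℝ^d` there exists a coupling
`γ` of the uniform distributions on `K` and `L` (i.e. random vectors `ξ`, `η` uniformly
distributed on `K`, `L` on a common probability space) with
`(∬ ‖x−y‖^p γ(dx,dy))^{1/p} ≤ (V_d(K △ L)/max(V_d(K),V_d(L)))^{1/p} diam(K ∪ L)`. -/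
theorem statement16
    {d : ℕ} (p : ℝ) (hp : 1 ≤ p)
    (K L : Set (EuclideanSpace ℝ (Fin d)))
    (hK : IsCompact K) (hKconv : Convex ℝ K) (hKint : (interior K).Nonempty)
    (hL : IsCompact L) (hLconv : Convex ℝ L) (hLint : (interior L).Nonempty) :
    ∃ γ : Measure (EuclideanSpace ℝ (Fin d) × EuclideanSpace ℝ (Fin d)),
      IsProbabilityMeasure γ ∧
      γ.map Prod.fst = unifOn K ∧
      γ.map Prod.snd = unifOn L ∧
      (∫ z, ‖z.1 - z.2‖ ^ p ∂γ) ^ (1 / p) ≤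
        ((volume (symmDiff K L)).toReal /
            max (volume K).toReal (volume L).toReal) ^ (1 / p) *
          Metric.diam (K ∪ L) := by
  have hK0 : volume K ≠ 0 := (Measure.measure_pos_of_nonempty_interior volume hKint).ne'
  have hL0 : volume L ≠ 0 := (Measure.measure_pos_of_nonempty_interior volume hLint).ne'
  have hKtop : volume K ≠ ⊤ := hK.measure_lt_top.ne
  have hLtop : volume L ≠ ⊤ := hL.measure_lt_top.ne
  have hPK := isProbabilityMeasure_unifOn hK0 hKtop
  have hPL := isProbabilityMeasure_unifOn hL0 hLtop
  obtain ⟨γ, h1, h2, hdiag⟩ := exists_coupling_compl_diagonal_le (unifOn K) (unifOn L)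
    ((max (volume K) (volume L))⁻¹ • volume.restrict (K ∩ L))
    (smul_restrict_le_unifOn Set.inter_subset_left (le_max_left _ _))
    (smul_restrict_le_unifOn Set.inter_subset_right (le_max_right _ _))
  have hγ : IsProbabilityMeasure γ := by
    have : IsProbabilityMeasure (γ.map Prod.fst) := h1 ▸ hPK
    exact Measure.isProbabilityMeasure_of_map Prod.fst
  refine ⟨γ, hγ, h1, h2, ?_⟩
  have hp0 : 0 < p := by linarith
  have hcost := integral_norm_sub_rpow_le_measureReal_mul_diam (γ := γ)
    (hK.union hL).isBounded hp0
    (h1 ▸ (ae_unifOn_mem hK.measurableSet).mono fun x hx => Or.inl hx)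
    (h2 ▸ (ae_unifOn_mem hL.measurableSet).mono fun x hx => Or.inr hx)
  have hmass : γ.real (Set.diagonal _)ᶜ ≤ (volume (symmDiff K L)).toReal /
      max (volume K).toReal (volume L).toReal := by
    rw [← ENNReal.toReal_max hKtop hLtop, ← ENNReal.toReal_div]
    refine ENNReal.toReal_mono (ENNReal.div_ne_top ?_ ?_) (hdiag.trans ?_)
    · exact measure_ne_top_of_subset (symmDiff_le_sup (a := K) (b := L))
        (hK.union hL).measure_lt_top.ne
    · exact (lt_max_of_lt_left hK0.bot_lt).ne'
    · simpa using one_sub_measure_inter_div_max_le volume hK0 hKtop hLtop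
  calc (∫ z, ‖z.1 - z.2‖ ^ p ∂γ) ^ (1 / p)
      ≤ ((volume (symmDiff K L)).toReal / max (volume K).toReal (volume L).toReal *
          Metric.diam (K ∪ L) ^ p) ^ (1 / p) := by
        refine Real.rpow_le_rpow (integral_nonneg fun z => by positivity)
          (hcost.trans ?_) (by positivity)
        gcongr
    _ = _ := by
        rw [Real.mul_rpow (by positivity) (by positivity), ← Real.rpow_mul Metric.diam_nonneg,
          mul_one_div_cancel hp0.ne', Real.rpow_one]
end
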